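/- arXiv:2402.17170 — 5 statements merged into one kernel-verified Lean document; each statement's English description precedes it below -/
import Mathlib

section
/- Let Ĥ be a symmetric n×n real matrix and G an m×n real matrix such that: (i) xᵀĤx ≥ γ_H‖x‖² for all x with Gx = 0; (ii) GGᵀ ⪰ γ_G I; (iii) the spectral norms satisfy ‖Ĥ‖ ≤ Υ and ‖G‖ ≤ Υ, where Υ ≥ 1 ≥ γ_H, γ_H > 0, and 0 < γ_G ≤ 1. Then for every scalar μ with μ ≥ (2Υ²/γ_H + γ_H + Υ)/γ_G, the matrix Ĥ + μGᵀG satisfies xᵀ(Ĥ + μGᵀG)x ≥ (γ_H/2)‖x‖² for all x ∈ ℝⁿ. -/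
open Matrix

/-- The spectral (ℓ²-operator) norm of a real matrix. -/
noncomputable def specNorm {α β : Type*} [Fintype α] [Fintype β] [DecidableEq β]
    (A : Matrix α β ℝ) : ℝ :=
  ‖LinearMap.toContinuousLinearMap (Matrix.toEuclideanLin A)‖

theorem norm_toLp_sq {α : Type*} [Fintype α] (x : α → ℝ) :
    ‖WithLp.toLp 2 x‖ ^ 2 = x ⬝ᵥ x := by
  rw [EuclideanSpace.norm_sq_eq]
  simp [dotProduct, sq]

theorem abs_dotProduct_mulVec_le_specNorm {α β : Type*} [Fintype α] [Fintype β] [DecidableEq β]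
    (A : Matrix α β ℝ) (y : α → ℝ) (x : β → ℝ) :
    |y ⬝ᵥ A *ᵥ x| ≤ specNorm A * ‖WithLp.toLp 2 x‖ * ‖WithLp.toLp 2 y‖ := by
  have h := (LinearMap.toContinuousLinearMap (Matrix.toEuclideanLin A)).le_opNorm
    (WithLp.toLp 2 x)
  have hc := abs_real_inner_le_norm (WithLp.toLp 2 (A *ᵥ x)) (WithLp.toLp 2 y)
  have he : inner ℝ (WithLp.toLp 2 (A *ᵥ x)) (WithLp.toLp 2 y) = y ⬝ᵥ A *ᵥ x := by
    simp [EuclideanSpace.inner_eq_star_dotProduct]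
  rw [he] at hc
  exact hc.trans (mul_le_mul_of_nonneg_right h (norm_nonneg _))

theorem dotProduct_transpose_mul_mulVec {α β : Type*} [Fintype α] [Fintype β]
    (A : Matrix α β ℝ) (x : β → ℝ) :
    x ⬝ᵥ (Aᵀ * A) *ᵥ x = A *ᵥ x ⬝ᵥ A *ᵥ x := by
  rw [← mulVec_mulVec, dotProduct_mulVec, vecMul_transpose]

theorem exists_mulVec_eq_of_coercive {α : Type*} [Fintype α] [DecidableEq α]
    (A : Matrix α α ℝ) {γ : ℝ} (hγ : 0 < γ)
    (hA : ∀ y : α → ℝ, γ * (y ⬝ᵥ y) ≤ y ⬝ᵥ A *ᵥ y) (z : α → ℝ) :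
    ∃ w, A *ᵥ w = z := by
  have hinj : Function.Injective A.mulVecLin := by
    rw [injective_iff_map_eq_zero]
    intro y hy
    have h := hA y
    rw [← mulVecLin_apply, hy, dotProduct_zero] at h
    have h0 : 0 ≤ y ⬝ᵥ y := norm_toLp_sq y ▸ sq_nonneg _
    exact dotProduct_self_eq_zero.mp (by nlinarith)
  exact LinearMap.surjective_of_injective hinj z

theorem coercive_on_range_transpose {α β : Type*} [Fintype α] [Fintype β]
    (G : Matrix α β ℝ) {γ : ℝ}
    (hG : ∀ y : α → ℝ, γ * (y ⬝ᵥ y) ≤ y ⬝ᵥ (G * Gᵀ) *ᵥ y) (w : α → ℝ) :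
    γ * (Gᵀ *ᵥ w ⬝ᵥ Gᵀ *ᵥ w) ≤ G *ᵥ (Gᵀ *ᵥ w) ⬝ᵥ G *ᵥ (Gᵀ *ᵥ w) := by
  have h := hG w
  have hwv : w ⬝ᵥ (G * Gᵀ) *ᵥ w = Gᵀ *ᵥ w ⬝ᵥ Gᵀ *ᵥ w := by
    simpa using dotProduct_transpose_mul_mulVec Gᵀ w
  have hcs : (w ⬝ᵥ (G * Gᵀ) *ᵥ w) ^ 2 ≤
      (w ⬝ᵥ w) * ((G * Gᵀ) *ᵥ w ⬝ᵥ (G * Gᵀ) *ᵥ w) := by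
    simpa [dotProduct, sq] using Finset.sum_mul_sq_le_sq_mul_sq Finset.univ w ((G * Gᵀ) *ᵥ w)
  rw [mulVec_mulVec]
  rw [hwv] at h hcs
  have hs : 0 ≤ Gᵀ *ᵥ w ⬝ᵥ Gᵀ *ᵥ w := norm_toLp_sq (Gᵀ *ᵥ w) ▸ sq_nonneg _
  have hq : 0 ≤ (G * Gᵀ) *ᵥ w ⬝ᵥ (G * Gᵀ) *ᵥ w := norm_toLp_sq ((G * Gᵀ) *ᵥ w) ▸ sq_nonneg _
  generalize Gᵀ *ᵥ w ⬝ᵥ Gᵀ *ᵥ w = s at *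
  generalize (G * Gᵀ) *ᵥ w ⬝ᵥ (G * Gᵀ) *ᵥ w = q at *
  rcases le_or_gt γ 0 with hγ | hγ
  · nlinarith
  rcases hs.eq_or_lt with rfl | hs
  · simpa using hq
  · refine le_of_mul_le_mul_left ?_ hs
    nlinarith [mul_le_mul_of_nonneg_left hcs hγ.le, mul_le_mul_of_nonneg_right h hq]

/-- reduced positive definiteness of the augmented Hessian `Ĥ + μ Gᵀ G`. -/
theorem augmented_hessian_posdef (n m : ℕ) (γH γG Υ : ℝ)
    (hγH : 0 < γH) (hγH1 : γH ≤ 1) (hγG : 0 < γG) (hγG1 : γG ≤ 1) (hΥ : 1 ≤ Υ)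
    (Hh : Matrix (Fin n) (Fin n) ℝ) (G : Matrix (Fin m) (Fin n) ℝ)
    (hsymm : Hh.IsSymm)
    (hred : ∀ x : Fin n → ℝ, G.mulVec x = 0 → γH * (x ⬝ᵥ x) ≤ x ⬝ᵥ Hh.mulVec x)
    (hGG : ∀ y : Fin m → ℝ, γG * (y ⬝ᵥ y) ≤ y ⬝ᵥ (G * Gᵀ).mulVec y)
    (hHn : specNorm Hh ≤ Υ) (hGn : specNorm G ≤ Υ) :
    ∀ μ : ℝ, (2 * Υ ^ 2 / γH + γH + Υ) / γG ≤ μ →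
      ∀ x : Fin n → ℝ, (γH / 2) * (x ⬝ᵥ x) ≤ x ⬝ᵥ (Hh + μ • (Gᵀ * G)).mulVec x := by
  intro μ hμ x
  obtain ⟨w, hw⟩ := exists_mulVec_eq_of_coercive (G * Gᵀ) hγG hGG (G *ᵥ x)
  have hv := coercive_on_range_transpose G hGG w
  rw [← mulVec_mulVec] at hw
  have horth : ∀ u, G *ᵥ u = 0 → u ⬝ᵥ Gᵀ *ᵥ w = 0 := fun u hu => by
    rw [dotProduct_mulVec, vecMul_transpose, hu, zero_dotProduct]
  generalize Gᵀ *ᵥ w = v at hv hw horth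
  obtain ⟨u, rfl⟩ : ∃ u, x = u + v := ⟨x - v, by simp⟩
  have hu : G *ᵥ u = 0 := by simpa [mulVec_add] using hw.symm
  have hpen : (u + v) ⬝ᵥ (Gᵀ * G) *ᵥ (u + v) = G *ᵥ v ⬝ᵥ G *ᵥ v := by
    rw [dotProduct_transpose_mul_mulVec, hw]
  have huv := horth u hu
  have hlow : 2 * Υ ^ 2 / γH + γH + Υ ≤ μ * γG := (div_le_iff₀ hγG).mp hμ
  have hμ0 : 0 ≤ μ := le_trans (by positivity) hμ
  have bound : ∀ y z : Fin n → ℝ,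
      -(Υ * ‖WithLp.toLp 2 z‖ * ‖WithLp.toLp 2 y‖) ≤ y ⬝ᵥ Hh *ᵥ z := fun y z =>
    neg_le_of_abs_le ((abs_dotProduct_mulVec_le_specNorm Hh y z).trans (by gcongr))
  have huu := hred u hu
  have h1 := bound u v
  have h2 := bound v u
  have h3 := bound v v
  have hxx : (u + v) ⬝ᵥ (u + v) = u ⬝ᵥ u + v ⬝ᵥ v := by
    simp [add_dotProduct, dotProduct_add, huv, dotProduct_comm v u]
  rw [hxx, add_mulVec, smul_mulVec, dotProduct_add _ (Hh *ᵥ _), dotProduct_smul, hpen, smul_eq_mul]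
  simp only [mulVec_add, dotProduct_add, add_dotProduct]
  rw [← norm_toLp_sq u] at huu ⊢
  rw [← norm_toLp_sq v] at hv ⊢
  generalize ‖WithLp.toLp 2 u‖ = a at *
  generalize ‖WithLp.toLp 2 v‖ = b at *
  have h4 : (2 * Υ ^ 2 / γH + γH + Υ) * b ^ 2 ≤ μ * (G *ᵥ v ⬝ᵥ G *ᵥ v) := by
    nlinarith [mul_le_mul_of_nonneg_left hv hμ0, mul_le_mul_of_nonneg_right hlow (sq_nonneg b)]
  have h5 : 2 * Υ * a * b ≤ γH / 2 * a ^ 2 + 2 * Υ ^ 2 / γH * b ^ 2 := by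
    have h : γH / 2 * a ^ 2 + 2 * Υ ^ 2 / γH * b ^ 2 - 2 * Υ * a * b =
        (γH * a - 2 * Υ * b) ^ 2 / (2 * γH) := by
      field_simp
      ring
    have : 0 ≤ (γH * a - 2 * Υ * b) ^ 2 / (2 * γH) := by positivity
    linarith
  nlinarith [mul_nonneg hγH.le (sq_nonneg b)]
end

section
/- Let Ĥ be a symmetric n×n real matrix and G an m×n real matrix such that: (i) xᵀĤx ≥ γ_H‖x‖² for all x with Gx = 0; (ii) GGᵀ ⪰ γ_G I; (iii) ‖Ĥ‖ ≤ Υ and ‖G‖ ≤ Υ, where Υ ≥ 1, 0 < γ_H ≤ 1, and 0 < γ_G ≤ 1. Then the (n+m)×(n+m) KKT block matrix K = [[Ĥ, Gᵀ], [G, 0]] is invertible and its spectral norm satisfies ‖K⁻¹‖ ≤ 4Υ²/(γ_H γ_G). -/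
open Matrix

section EuclideanNorm

variable {α β : Type*} [Fintype α] [Fintype β]

/-- The Euclidean norm of a real vector. -/
noncomputable def eucNorm (x : α → ℝ) : ℝ := ‖WithLp.toLp 2 x‖

lemma eucNorm_nonneg (x : α → ℝ) : 0 ≤ eucNorm x := norm_nonneg _

lemma eucNorm_sq (x : α → ℝ) : eucNorm x ^ 2 = x ⬝ᵥ x := by
  rw [eucNorm, EuclideanSpace.norm_sq_eq]
  simp [dotProduct, sq]

lemma eucNorm_eq_zero {x : α → ℝ} : eucNorm x = 0 ↔ x = 0 := by
  simp [eucNorm]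

lemma eucNorm_add_le (x y : α → ℝ) : eucNorm (x + y) ≤ eucNorm x + eucNorm y := by
  simpa [eucNorm] using norm_add_le (WithLp.toLp 2 x) (WithLp.toLp 2 y)

lemma eucNorm_sub_le (x y : α → ℝ) : eucNorm (x - y) ≤ eucNorm x + eucNorm y := by
  simpa [eucNorm] using norm_sub_le (WithLp.toLp 2 x) (WithLp.toLp 2 y)

lemma abs_dotProduct_le (x y : α → ℝ) : |x ⬝ᵥ y| ≤ eucNorm x * eucNorm y := by
  have h := abs_real_inner_le_norm (WithLp.toLp 2 x) (WithLp.toLp 2 y)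
  rw [EuclideanSpace.inner_toLp_toLp, star_trivial, dotProduct_comm] at h
  exact h

lemma eucNorm_sumElim_sq (x : α → ℝ) (y : β → ℝ) :
    eucNorm (Sum.elim x y) ^ 2 = eucNorm x ^ 2 + eucNorm y ^ 2 := by
  simp [eucNorm_sq, sumElim_dotProduct_sumElim]

lemma eucNorm_mulVec_le [DecidableEq β] (A : Matrix α β ℝ) (x : β → ℝ) :
    eucNorm (A *ᵥ x) ≤ specNorm A * eucNorm x :=
  (LinearMap.toContinuousLinearMap (Matrix.toEuclideanLin A)).le_opNorm (WithLp.toLp 2 x)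

lemma specNorm_le_of_forall [DecidableEq β] (A : Matrix α β ℝ) {C : ℝ} (hC : 0 ≤ C)
    (h : ∀ x, eucNorm (A *ᵥ x) ≤ C * eucNorm x) : specNorm A ≤ C :=
  ContinuousLinearMap.opNorm_le_bound _ hC fun x => h x.ofLp

/-- A matrix which is bounded below by `C⁻¹` is invertible, with inverse of norm at most `C`. -/
lemma isUnit_det_and_specNorm_inv_le [DecidableEq α] (A : Matrix α α ℝ) {C : ℝ} (hC : 0 ≤ C)
    (h : ∀ x, eucNorm x ≤ C * eucNorm (A *ᵥ x)) :
    IsUnit A.det ∧ specNorm A⁻¹ ≤ C := by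
  have hu : IsUnit A.det := by
    rw [isUnit_iff_ne_zero]
    intro hdet
    obtain ⟨x, hx, hAx⟩ := Matrix.exists_mulVec_eq_zero_iff.2 hdet
    have h0 := h x
    rw [hAx, eucNorm_eq_zero.2 rfl, mul_zero] at h0
    exact hx (eucNorm_eq_zero.1 (h0.antisymm (eucNorm_nonneg x)))
  refine ⟨hu, specNorm_le_of_forall _ hC fun x => ?_⟩
  simpa [Matrix.mulVec_mulVec, Matrix.mul_nonsing_inv A hu] using h (A⁻¹ *ᵥ x)

lemma eucNorm_transpose_mulVec_sq (G : Matrix β α ℝ) (y : β → ℝ) :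
    eucNorm (Gᵀ *ᵥ y) ^ 2 = y ⬝ᵥ (G * Gᵀ) *ᵥ y := by
  rw [eucNorm_sq, ← Matrix.mulVec_mulVec, Matrix.dotProduct_mulVec y, Matrix.mulVec_transpose]

lemma mul_eucNorm_le_eucNorm_transpose_mulVec {G : Matrix β α ℝ} {s : ℝ} (hs : 0 ≤ s)
    (hGG : ∀ y : β → ℝ, s ^ 2 * (y ⬝ᵥ y) ≤ y ⬝ᵥ (G * Gᵀ) *ᵥ y) (y : β → ℝ) :
    s * eucNorm y ≤ eucNorm (Gᵀ *ᵥ y) := by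
  refine (sq_le_sq₀ (mul_nonneg hs (eucNorm_nonneg y)) (eucNorm_nonneg _)).1 ?_
  rw [mul_pow, eucNorm_sq y, eucNorm_transpose_mulVec_sq]
  exact hGG y

/-- If `G * Gᵀ` is bounded below by `s ^ 2`, then `G *ᵥ v = b` has a solution of norm at most
`‖b‖ / s`. -/
lemma exists_mulVec_eq_and_mul_eucNorm_le [DecidableEq β] {G : Matrix β α ℝ} {s : ℝ} (hs : 0 < s)
    (hGG : ∀ y : β → ℝ, s ^ 2 * (y ⬝ᵥ y) ≤ y ⬝ᵥ (G * Gᵀ) *ᵥ y) (b : β → ℝ) :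
    ∃ v, G *ᵥ v = b ∧ s * eucNorm v ≤ eucNorm b := by
  have hu : IsUnit (G * Gᵀ).det := by
    rw [isUnit_iff_ne_zero]
    intro hdet
    obtain ⟨y, hy, hGy⟩ := Matrix.exists_mulVec_eq_zero_iff.2 hdet
    have h0 := hGG y
    rw [hGy, dotProduct_zero, ← eucNorm_sq] at h0
    have hpos : 0 < eucNorm y :=
      (eucNorm_nonneg y).lt_of_ne' (mt eucNorm_eq_zero.1 hy)
    have : 0 < s ^ 2 * eucNorm y ^ 2 := by positivity
    linarith
  set w := (G * Gᵀ)⁻¹ *ᵥ b with hw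
  have hGw : (G * Gᵀ) *ᵥ w = b := by
    rw [hw, Matrix.mulVec_mulVec, Matrix.mul_nonsing_inv _ hu, Matrix.one_mulVec]
  refine ⟨Gᵀ *ᵥ w, by rw [Matrix.mulVec_mulVec, hGw], ?_⟩
  have h1 := mul_eucNorm_le_eucNorm_transpose_mulVec hs.le hGG w
  have h2 := eucNorm_transpose_mulVec_sq G w
  rw [hGw] at h2
  have h3 := (le_abs_self _).trans (abs_dotProduct_le w b)
  rcases (eucNorm_nonneg (Gᵀ *ᵥ w)).eq_or_lt with h0 | h0
  · rw [← h0, mul_zero]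
    exact eucNorm_nonneg b
  · refine le_of_mul_le_mul_left ?_ h0
    nlinarith [mul_le_mul_of_nonneg_right h1 (eucNorm_nonneg b)]

end EuclideanNorm

section SaddlePoint

variable {α β : Type*} [Fintype α] [Fintype β] [DecidableEq α]

lemma eucNorm_primal_le [DecidableEq β] {Hh : Matrix α α ℝ} {G : Matrix β α ℝ} {γ s Υ : ℝ}
    (hγ : 0 < γ) (hγ1 : γ ≤ 1) (hs : 0 < s) (hΥ : 1 ≤ Υ)
    (hred : ∀ x : α → ℝ, G *ᵥ x = 0 → γ * (x ⬝ᵥ x) ≤ x ⬝ᵥ Hh *ᵥ x)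
    (hGG : ∀ y : β → ℝ, s ^ 2 * (y ⬝ᵥ y) ≤ y ⬝ᵥ (G * Gᵀ) *ᵥ y)
    (hH : specNorm Hh ≤ Υ) (x : α → ℝ) (y : β → ℝ) :
    γ * s * eucNorm x ≤ s * eucNorm (Hh *ᵥ x + Gᵀ *ᵥ y) + 2 * Υ * eucNorm (G *ᵥ x) := by
  obtain ⟨v, hGv, hv⟩ := exists_mulVec_eq_and_mul_eucNorm_le hs hGG (G *ᵥ x)
  set a := Hh *ᵥ x + Gᵀ *ᵥ y with ha
  obtain ⟨u, rfl⟩ : ∃ u, x = u + v := ⟨x - v, by simp⟩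
  have hGu : G *ᵥ u = 0 := by
    rw [Matrix.mulVec_add] at hGv
    simpa using hGv
  have horth : u ⬝ᵥ Gᵀ *ᵥ y = 0 := by
    rw [Matrix.dotProduct_mulVec, Matrix.vecMul_transpose, hGu, zero_dotProduct]
  have hquad : u ⬝ᵥ Hh *ᵥ u = u ⬝ᵥ a - u ⬝ᵥ Hh *ᵥ v := by
    rw [ha, dotProduct_add, horth, Matrix.mulVec_add, dotProduct_add]
    ring
  have hu := hred u hGu
  rw [hquad, ← eucNorm_sq] at hu
  have h1 := (le_abs_self _).trans (abs_dotProduct_le u a)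
  have h2 := (neg_le_abs _).trans (abs_dotProduct_le u (Hh *ᵥ v))
  have h3 : eucNorm (Hh *ᵥ v) ≤ Υ * eucNorm v :=
    (eucNorm_mulVec_le Hh v).trans (mul_le_mul_of_nonneg_right hH (eucNorm_nonneg v))
  have hv0 := eucNorm_nonneg v
  have hγu : γ * eucNorm u ≤ eucNorm a + Υ * eucNorm v := by
    rcases (eucNorm_nonneg u).eq_or_lt with h0 | h0
    · rw [← h0, mul_zero]
      have := eucNorm_nonneg a
      positivity
    · refine le_of_mul_le_mul_left ?_ h0
      nlinarith [mul_le_mul_of_nonneg_left h3 h0.le]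
  calc γ * s * eucNorm (u + v) ≤ γ * s * (eucNorm u + eucNorm v) := by
        gcongr
        exact eucNorm_add_le u v
    _ = s * (γ * eucNorm u) + γ * (s * eucNorm v) := by ring
    _ ≤ s * (eucNorm a + Υ * eucNorm v) + Υ * (s * eucNorm v) := by
        gcongr
        exact hγ1.trans hΥ
    _ = s * eucNorm a + 2 * Υ * (s * eucNorm v) := by ring
    _ ≤ s * eucNorm a + 2 * Υ * eucNorm (G *ᵥ (u + v)) := by gcongr

lemma eucNorm_dual_le {Hh : Matrix α α ℝ} {G : Matrix β α ℝ} {s Υ : ℝ} (hs : 0 < s)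
    (hGG : ∀ y : β → ℝ, s ^ 2 * (y ⬝ᵥ y) ≤ y ⬝ᵥ (G * Gᵀ) *ᵥ y)
    (hH : specNorm Hh ≤ Υ) (x : α → ℝ) (y : β → ℝ) :
    s * eucNorm y ≤ eucNorm (Hh *ᵥ x + Gᵀ *ᵥ y) + Υ * eucNorm x := by
  have h1 := mul_eucNorm_le_eucNorm_transpose_mulVec hs.le hGG y
  have h2 := eucNorm_sub_le (Hh *ᵥ x + Gᵀ *ᵥ y) (Hh *ᵥ x)
  rw [add_sub_cancel_left] at h2
  have h3 := (eucNorm_mulVec_le Hh x).trans (mul_le_mul_of_nonneg_right hH (eucNorm_nonneg x))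
  linarith

lemma eucNorm_sumElim_le_kkt [DecidableEq β] {Hh : Matrix α α ℝ} {G : Matrix β α ℝ} {γ s Υ : ℝ}
    (hγ : 0 < γ) (hγ1 : γ ≤ 1) (hs : 0 < s) (hs1 : s ≤ 1) (hΥ : 1 ≤ Υ)
    (hred : ∀ x : α → ℝ, G *ᵥ x = 0 → γ * (x ⬝ᵥ x) ≤ x ⬝ᵥ Hh *ᵥ x)
    (hGG : ∀ y : β → ℝ, s ^ 2 * (y ⬝ᵥ y) ≤ y ⬝ᵥ (G * Gᵀ) *ᵥ y)
    (hH : specNorm Hh ≤ Υ) (x : α → ℝ) (y : β → ℝ) :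
    eucNorm (Sum.elim x y) ≤ 4 * Υ ^ 2 / (γ * s ^ 2) *
      eucNorm (Sum.elim (Hh *ᵥ x + Gᵀ *ᵥ y) (G *ᵥ x)) := by
  have hx := eucNorm_primal_le hγ hγ1 hs hΥ hred hGG hH x y
  have hy := eucNorm_dual_le hs hGG hH x y
  have hsum := eucNorm_sumElim_sq x y
  have hsum' := eucNorm_sumElim_sq (Hh *ᵥ x + Gᵀ *ᵥ y) (G *ᵥ x)
  have hx0 := eucNorm_nonneg x
  have hy0 := eucNorm_nonneg y
  have hA := eucNorm_nonneg (Hh *ᵥ x + Gᵀ *ᵥ y)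
  have hB := eucNorm_nonneg (G *ᵥ x)
  have hC := eucNorm_nonneg (Sum.elim (Hh *ᵥ x + Gᵀ *ᵥ y) (G *ᵥ x))
  have hD := eucNorm_nonneg (Sum.elim x y)
  generalize eucNorm (Sum.elim (Hh *ᵥ x + Gᵀ *ᵥ y) (G *ᵥ x)) = C at *
  generalize eucNorm (Sum.elim x y) = D at *
  generalize eucNorm (Hh *ᵥ x + Gᵀ *ᵥ y) = A at *
  generalize eucNorm (G *ᵥ x) = B at *
  generalize eucNorm x = X at *
  generalize eucNorm y = Y at *
  have hΥ0 : 0 < Υ := by linarith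
  have hΥ2 : Υ ≤ Υ ^ 2 := by nlinarith
  have hX : γ * s ^ 2 * X ≤ Υ ^ 2 * (A + 2 * B) := by
    have h1 : s * (s * A) ≤ Υ ^ 2 * A := by
      rw [← mul_assoc]
      gcongr
      nlinarith
    have h2 : s * (2 * Υ * B) ≤ Υ ^ 2 * (2 * B) := by
      have h : s * Υ ≤ Υ ^ 2 := by nlinarith
      nlinarith [mul_le_mul_of_nonneg_right h hB]
    nlinarith [mul_le_mul_of_nonneg_left hx hs.le]
  have hY : γ * s ^ 2 * Y ≤ Υ ^ 2 * (2 * A + 2 * B) := by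
    have h1 : γ * s * A ≤ Υ ^ 2 * A := by
      gcongr
      nlinarith [mul_le_mul hγ1 hs1 hs.le zero_le_one]
    have h2 : Υ * (s * A) ≤ Υ ^ 2 * A := by
      rw [← mul_assoc]
      gcongr
      nlinarith
    nlinarith [mul_le_mul_of_nonneg_left hx hΥ0.le,
      mul_le_mul_of_nonneg_left hy (mul_pos hγ hs).le]
  rw [div_mul_eq_mul_div, le_div_iff₀ (by positivity), mul_comm D]
  refine (sq_le_sq₀ (by positivity) (by positivity)).1 ?_
  calc (γ * s ^ 2 * D) ^ 2 = (γ * s ^ 2 * X) ^ 2 + (γ * s ^ 2 * Y) ^ 2 := by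
        rw [mul_pow, hsum]
        ring
    _ ≤ (Υ ^ 2 * (A + 2 * B)) ^ 2 + (Υ ^ 2 * (2 * A + 2 * B)) ^ 2 := by gcongr
    _ = (Υ ^ 2) ^ 2 * (5 * A ^ 2 + 12 * (A * B) + 8 * B ^ 2) := by ring
    _ ≤ (Υ ^ 2) ^ 2 * (16 * (A ^ 2 + B ^ 2)) := by
        gcongr
        nlinarith [sq_nonneg (A - B)]
    _ = (4 * Υ ^ 2 * C) ^ 2 := by
        rw [mul_pow _ C, hsum']
        ring

end SaddlePoint

/-- the KKT matrix `K = [[Ĥ, Gᵀ], [G, 0]]` is invertible with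
`‖K⁻¹‖ ≤ 4Υ²/(γ_H γ_G)`. -/
theorem kkt_inverse_bound (n m : ℕ) (γH γG Υ : ℝ)
    (hγH : 0 < γH) (hγH1 : γH ≤ 1) (hγG : 0 < γG) (hγG1 : γG ≤ 1) (hΥ : 1 ≤ Υ)
    (Hh : Matrix (Fin n) (Fin n) ℝ) (G : Matrix (Fin m) (Fin n) ℝ)
    (hsymm : Hh.IsSymm)
    (hred : ∀ x : Fin n → ℝ, G.mulVec x = 0 → γH * (x ⬝ᵥ x) ≤ x ⬝ᵥ Hh.mulVec x)
    (hGG : ∀ y : Fin m → ℝ, γG * (y ⬝ᵥ y) ≤ y ⬝ᵥ (G * Gᵀ).mulVec y)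
    (hHn : specNorm Hh ≤ Υ) (hGn : specNorm G ≤ Υ) :
    IsUnit (Matrix.fromBlocks Hh Gᵀ G 0).det ∧
      specNorm (Matrix.fromBlocks Hh Gᵀ G 0)⁻¹ ≤ 4 * Υ ^ 2 / (γH * γG) := by
  refine isUnit_det_and_specNorm_inv_le _ (by positivity) fun z => ?_
  have hs := Real.sq_sqrt hγG.le
  rw [← hs] at hGG
  have h := eucNorm_sumElim_le_kkt hγH hγH1 (Real.sqrt_pos.2 hγG) (Real.sqrt_le_one.2 hγG1) hΥ
    hred hGG hHn (z ∘ Sum.inl) (z ∘ Sum.inr)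
  rw [hs, Sum.elim_comp_inl_inr] at h
  simpa [Matrix.fromBlocks_mulVec] using h
end

section
/- Let Ĥ be a symmetric n×n real matrix and G an m×n real matrix such that xᵀĤx ≥ γ_H‖x‖² for all x with Gx = 0, GGᵀ ⪰ γ_G I, ‖Ĥ‖ ≤ Υ, and ‖G‖ ≤ Υ, where Υ ≥ 1, 0 < γ_H ≤ 1, 0 < γ_G ≤ 1. Let Z be an n×k real matrix with ZᵀZ = I_k, GZ = 0, and ZZᵀ + Gᵀ(GGᵀ)⁻¹G = I_n, and set B₁ = Z(ZᵀĤZ)⁻¹Zᵀ, B₂ = (GGᵀ)⁻¹G(I − ĤZ(ZᵀĤZ)⁻¹Zᵀ), B₃ = (GGᵀ)⁻¹G(ĤZ(ZᵀĤZ)⁻¹ZᵀĤ − Ĥ)Gᵀ(GGᵀ)⁻¹ (all inverses exist under the stated assumptions). Then the spectral norms satisfy ‖B₁‖ ≤ 1/γ_H, ‖B₂‖ ≤ (1 + Υ/γ_H)/√γ_G, and ‖B₃‖ ≤ (Υ + Υ²/γ_H)/γ_G. -/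
open Matrix

/-- `B₁ = Z (Zᵀ Ĥ Z)⁻¹ Zᵀ`. -/
noncomputable def B1 {n k : ℕ} (Hh : Matrix (Fin n) (Fin n) ℝ)
    (Z : Matrix (Fin n) (Fin k) ℝ) : Matrix (Fin n) (Fin n) ℝ :=
  Z * (Zᵀ * Hh * Z)⁻¹ * Zᵀ

/-- `B₂ = (G Gᵀ)⁻¹ G (I − Ĥ Z (Zᵀ Ĥ Z)⁻¹ Zᵀ)`. -/
noncomputable def B2 {n m k : ℕ} (Hh : Matrix (Fin n) (Fin n) ℝ)
    (G : Matrix (Fin m) (Fin n) ℝ) (Z : Matrix (Fin n) (Fin k) ℝ) :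
    Matrix (Fin m) (Fin n) ℝ :=
  (G * Gᵀ)⁻¹ * G * (1 - Hh * Z * (Zᵀ * Hh * Z)⁻¹ * Zᵀ)

/-- `B₃ = (G Gᵀ)⁻¹ G (Ĥ Z (Zᵀ Ĥ Z)⁻¹ Zᵀ Ĥ − Ĥ) Gᵀ (G Gᵀ)⁻¹`. -/
noncomputable def B3 {n m k : ℕ} (Hh : Matrix (Fin n) (Fin n) ℝ)
    (G : Matrix (Fin m) (Fin n) ℝ) (Z : Matrix (Fin n) (Fin k) ℝ) :
    Matrix (Fin m) (Fin m) ℝ :=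
  (G * Gᵀ)⁻¹ * G * (Hh * Z * (Zᵀ * Hh * Z)⁻¹ * Zᵀ * Hh - Hh) * Gᵀ * (G * Gᵀ)⁻¹

section SpectralNorm

open scoped Matrix.Norms.L2Operator

variable {α β δ : Type*} [Fintype α] [Fintype β] [Fintype δ]

theorem specNorm_eq_l2_opNorm [DecidableEq β] (A : Matrix α β ℝ) : specNorm A = ‖A‖ := rfl

theorem specNorm_nonneg [DecidableEq β] (A : Matrix α β ℝ) : 0 ≤ specNorm A := norm_nonneg _

theorem specNorm_mul_le [DecidableEq β] [DecidableEq δ] (A : Matrix α β ℝ) (B : Matrix β δ ℝ) :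
    specNorm (A * B) ≤ specNorm A * specNorm B := by
  simpa only [specNorm_eq_l2_opNorm] using l2_opNorm_mul A B

theorem specNorm_sub_le [DecidableEq β] (A B : Matrix α β ℝ) :
    specNorm (A - B) ≤ specNorm A + specNorm B := by
  simpa only [specNorm_eq_l2_opNorm] using norm_sub_le A B

theorem specNorm_transpose [DecidableEq α] [DecidableEq β] (A : Matrix α β ℝ) :
    specNorm Aᵀ = specNorm A := by
  simpa only [specNorm_eq_l2_opNorm, conjTranspose_eq_transpose_of_trivial] using
    l2_opNorm_conjTranspose A

theorem specNorm_transpose_mul_self [DecidableEq β] (A : Matrix α β ℝ) :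
    specNorm (Aᵀ * A) = specNorm A ^ 2 := by
  simpa only [specNorm_eq_l2_opNorm, conjTranspose_eq_transpose_of_trivial, sq] using
    l2_opNorm_conjTranspose_mul_self A

theorem specNorm_one_le [DecidableEq α] : specNorm (1 : Matrix α α ℝ) ≤ 1 := by
  rw [specNorm_eq_l2_opNorm, ← diagonal_one, l2_opNorm_diagonal]
  exact (pi_norm_le_iff_of_nonneg zero_le_one).2 fun _ => by simp

theorem specNorm_le_one_of_transpose_mul_self [DecidableEq β] {Z : Matrix α β ℝ}
    (hZ : Zᵀ * Z = 1) :
    specNorm Z ≤ 1 := by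
  have h := specNorm_transpose_mul_self Z
  rw [hZ] at h
  have h1 := specNorm_one_le (α := β)
  nlinarith [specNorm_nonneg Z]

/-- A coercive real matrix expands Euclidean norms by at least its coercivity constant. -/
theorem mul_norm_le_norm_mulVec_of_coercive {S : Matrix α α ℝ} {γ : ℝ}
    (hS : ∀ x : α → ℝ, γ * (x ⬝ᵥ x) ≤ x ⬝ᵥ S.mulVec x) (x : α → ℝ) :
    γ * ‖WithLp.toLp 2 x‖ ≤ ‖WithLp.toLp 2 (S.mulVec x)‖ := by
  have hinner : ∀ u v : α → ℝ, u ⬝ᵥ v = inner ℝ (WithLp.toLp 2 u) (WithLp.toLp 2 v) := by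
    intro u v
    simp [EuclideanSpace.inner_eq_star_dotProduct, dotProduct_comm]
  have h := hS x
  rw [hinner, hinner, real_inner_self_eq_norm_sq] at h
  have h2 := h.trans (real_inner_le_norm _ _)
  rcases (norm_nonneg (WithLp.toLp 2 x)).eq_or_lt with h0 | h0
  · rw [← h0, mul_zero]
    exact norm_nonneg _
  · nlinarith

theorem isUnit_det_of_coercive [DecidableEq α] {S : Matrix α α ℝ} {γ : ℝ} (hγ : 0 < γ)
    (hS : ∀ x : α → ℝ, γ * (x ⬝ᵥ x) ≤ x ⬝ᵥ S.mulVec x) : IsUnit S.det := by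
  rw [isUnit_iff_ne_zero]
  intro h
  obtain ⟨v, hv, hSv⟩ := exists_mulVec_eq_zero_iff.2 h
  have := hS v
  rw [hSv, dotProduct_zero] at this
  have hnonneg : 0 ≤ v ⬝ᵥ v := by simpa using dotProduct_star_self_nonneg v
  exact hv (dotProduct_self_eq_zero.1 (by nlinarith))

theorem specNorm_inv_le_of_coercive [DecidableEq α] {S : Matrix α α ℝ} {γ : ℝ} (hγ : 0 < γ)
    (hS : ∀ x : α → ℝ, γ * (x ⬝ᵥ x) ≤ x ⬝ᵥ S.mulVec x) : specNorm S⁻¹ ≤ 1 / γ := by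
  refine ContinuousLinearMap.opNorm_le_bound _ (by positivity) fun y => ?_
  have h := mul_norm_le_norm_mulVec_of_coercive hS (S⁻¹.mulVec y.ofLp)
  rw [mulVec_mulVec, mul_nonsing_inv S (isUnit_det_of_coercive hγ hS), one_mulVec] at h
  rw [one_div, inv_mul_eq_div, le_div_iff₀' hγ]
  exact h

end SpectralNorm

theorem specNorm_inv_mul_le_of_coercive {α β : Type*} [Fintype α] [Fintype β]
    [DecidableEq α] [DecidableEq β] {G : Matrix α β ℝ} {γ : ℝ} (hγ : 0 < γ)
    (hG : ∀ y : α → ℝ, γ * (y ⬝ᵥ y) ≤ y ⬝ᵥ (G * Gᵀ).mulVec y) :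
    specNorm ((G * Gᵀ)⁻¹ * G) ≤ 1 / √γ := by
  have hdet := isUnit_det_of_coercive hγ hG
  have hinv := specNorm_inv_le_of_coercive hγ hG
  have hPP : (G * Gᵀ)⁻¹ * G * ((G * Gᵀ)⁻¹ * G)ᵀ = (G * Gᵀ)⁻¹ := by
    rw [transpose_mul, transpose_nonsing_inv, transpose_mul,
      transpose_transpose, Matrix.mul_assoc, ← Matrix.mul_assoc G,
      mul_nonsing_inv _ hdet, Matrix.mul_one]
  have h := specNorm_transpose_mul_self ((G * Gᵀ)⁻¹ * G)ᵀ
  rw [transpose_transpose, hPP, specNorm_transpose] at h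
  rw [h] at hinv
  have hsqrt := Real.le_sqrt_of_sq_le hinv
  rwa [Real.sqrt_div zero_le_one, Real.sqrt_one] at hsqrt

theorem specNorm_B1_le {n k : ℕ} {Hh : Matrix (Fin n) (Fin n) ℝ}
    {Z : Matrix (Fin n) (Fin k) ℝ} {γ : ℝ} (hγ : 0 < γ) (hZ : Zᵀ * Z = 1)
    (hH : ∀ y : Fin k → ℝ, γ * (y ⬝ᵥ y) ≤ y ⬝ᵥ (Zᵀ * Hh * Z).mulVec y) :
    specNorm (B1 Hh Z) ≤ 1 / γ := by
  have hZ1 := specNorm_le_one_of_transpose_mul_self hZ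
  have hinv := specNorm_inv_le_of_coercive hγ hH
  calc specNorm (B1 Hh Z)
      ≤ specNorm Z * specNorm (Zᵀ * Hh * Z)⁻¹ * specNorm Zᵀ :=
        (specNorm_mul_le _ _).trans
          (mul_le_mul_of_nonneg_right (specNorm_mul_le _ _) (specNorm_nonneg _))
    _ ≤ 1 * (1 / γ) * 1 := by
        rw [specNorm_transpose]
        have := specNorm_nonneg Z
        have := specNorm_nonneg (Zᵀ * Hh * Z)⁻¹
        gcongr
    _ = 1 / γ := by ring

/-- spectral norm bounds for the blocks of the KKT inverse. -/
theorem kkt_inverse_block_bounds (n m k : ℕ) (γH γG Υ : ℝ)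
    (hγH : 0 < γH) (hγH1 : γH ≤ 1) (hγG : 0 < γG) (hγG1 : γG ≤ 1) (hΥ : 1 ≤ Υ)
    (Hh : Matrix (Fin n) (Fin n) ℝ) (G : Matrix (Fin m) (Fin n) ℝ)
    (Z : Matrix (Fin n) (Fin k) ℝ)
    (hsymm : Hh.IsSymm)
    (hred : ∀ x : Fin n → ℝ, G.mulVec x = 0 → γH * (x ⬝ᵥ x) ≤ x ⬝ᵥ Hh.mulVec x)
    (hGG : ∀ y : Fin m → ℝ, γG * (y ⬝ᵥ y) ≤ y ⬝ᵥ (G * Gᵀ).mulVec y)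
    (hHn : specNorm Hh ≤ Υ) (hGn : specNorm G ≤ Υ)
    (hZorth : Zᵀ * Z = 1) (hGZ : G * Z = 0)
    (hproj : Z * Zᵀ + Gᵀ * (G * Gᵀ)⁻¹ * G = 1) :
    specNorm (B1 Hh Z) ≤ 1 / γH ∧
      specNorm (B2 Hh G Z) ≤ (1 + Υ / γH) / Real.sqrt γG ∧
      specNorm (B3 Hh G Z) ≤ (Υ + Υ ^ 2 / γH) / γG := by
  have hM : ∀ y : Fin k → ℝ, γH * (y ⬝ᵥ y) ≤ y ⬝ᵥ (Zᵀ * Hh * Z).mulVec y := by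
    intro y
    have h := hred (Z.mulVec y) (by rw [mulVec_mulVec, hGZ, zero_mulVec])
    have hmove : ∀ w : Fin n → ℝ, Z.mulVec y ⬝ᵥ w = y ⬝ᵥ Zᵀ.mulVec w := fun w => by
      rw [dotProduct_mulVec, vecMul_transpose]
    rwa [hmove, hmove, mulVec_mulVec, mulVec_mulVec, mulVec_mulVec, hZorth, one_mulVec] at h
  have hB1 := specNorm_B1_le hγH hZorth hM
  have hP := specNorm_inv_mul_le_of_coercive hγG hGG
  have hB2_eq : B2 Hh G Z = (G * Gᵀ)⁻¹ * G * (1 - Hh * B1 Hh Z) := by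
    simp only [B1, B2, Matrix.mul_assoc]
  have hB3_eq : B3 Hh G Z =
      (G * Gᵀ)⁻¹ * G * (Hh * B1 Hh Z * Hh - Hh) * ((G * Gᵀ)⁻¹ * G)ᵀ := by
    simp only [B1, B3, transpose_mul, transpose_nonsing_inv, transpose_transpose,
      Matrix.mul_assoc]
  have hΥ0 : 0 ≤ Υ := zero_le_one.trans hΥ
  have hHB : specNorm (Hh * B1 Hh Z) ≤ Υ * (1 / γH) :=
    (specNorm_mul_le _ _).trans (mul_le_mul hHn hB1 (specNorm_nonneg _) hΥ0)
  refine ⟨hB1, ?_, ?_⟩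
  · have hK : specNorm (1 - Hh * B1 Hh Z) ≤ 1 + Υ * (1 / γH) :=
      (specNorm_sub_le _ _).trans (add_le_add specNorm_one_le hHB)
    rw [hB2_eq]
    calc _ ≤ 1 / √γG * (1 + Υ * (1 / γH)) :=
          (specNorm_mul_le _ _).trans (mul_le_mul hP hK (specNorm_nonneg _) (by positivity))
      _ = _ := by ring
  · have hHBH : specNorm (Hh * B1 Hh Z * Hh) ≤ Υ * (1 / γH) * Υ :=
      (specNorm_mul_le _ _).trans (mul_le_mul hHB hHn (specNorm_nonneg _) (by positivity))
    have hK : specNorm (Hh * B1 Hh Z * Hh - Hh) ≤ Υ * (1 / γH) * Υ + Υ :=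
      (specNorm_sub_le _ _).trans (add_le_add hHBH hHn)
    have hPK := (specNorm_mul_le ((G * Gᵀ)⁻¹ * G) _).trans
      (mul_le_mul hP hK (specNorm_nonneg _) (by positivity))
    rw [hB3_eq]
    calc _ ≤ 1 / √γG * (Υ * (1 / γH) * Υ + Υ) * (1 / √γG) :=
          (specNorm_mul_le _ _).trans (mul_le_mul hPK ((specNorm_transpose _).trans_le hP)
            (specNorm_nonneg _) (by positivity))
      _ = (Υ + Υ ^ 2 / γH) / √γG ^ 2 := by ring
      _ = _ := by rw [Real.sq_sqrt hγG.le]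
end

section
/- Let Ĥ and H be symmetric n×n real matrices and G an m×n real matrix such that: (i) xᵀĤx ≥ γ_H‖x‖² for all x with Gx = 0; (ii) GGᵀ ⪰ γ_G I; (iii) ‖Ĥ‖ ≤ Υ, ‖H‖ ≤ Υ, ‖G‖ ≤ Υ, where Υ ≥ 1, 0 < γ_H ≤ 1, 0 < γ_G ≤ 1. Let g ∈ ℝⁿ and c ∈ ℝᵐ, and let (Δx, Δλ) ∈ ℝⁿ × ℝᵐ satisfy the Newton system Ĥ·Δx + Gᵀ·Δλ = −g and G·Δx = −c. Let η₁, η₂ > 0 satisfy η₂ ≤ γ_H/(7Υ²) and η₁ ≥ 9/(η₂γ_G). Then ⟨(Δx, Δλ), M·(g, c)⟩ ≤ −(η₂/8)(‖g‖² + ‖c‖²) − (η₂γ_G/8)(‖Δx‖² + ‖Δλ‖²), where M is the (n+m)×(n+m) block matrix [[I + η₂H, η₁Gᵀ], [η₂G, I]]. -/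
open Matrix

theorem two_mul_dotProduct_le {α : Type*} [Fintype α] (p q : α → ℝ) {t : ℝ} (ht : 0 < t) :
    2 * (p ⬝ᵥ q) ≤ t * (p ⬝ᵥ p) + 1 / t * (q ⬝ᵥ q) := by
  simp only [dotProduct, Finset.mul_sum, ← Finset.sum_add_distrib]
  refine Finset.sum_le_sum fun i _ => ?_
  have h : t * (p i * p i) + 1 / t * (q i * q i) - 2 * (p i * q i)
      = (t * p i - q i) ^ 2 / t := by
    field_simp
    ring
  have : 0 ≤ (t * p i - q i) ^ 2 / t := by positivity
  linarith

theorem neg_two_mul_dotProduct_le {α : Type*} [Fintype α] (p q : α → ℝ) {t : ℝ} (ht : 0 < t) :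
    -(2 * (p ⬝ᵥ q)) ≤ t * (p ⬝ᵥ p) + 1 / t * (q ⬝ᵥ q) := by
  have h := two_mul_dotProduct_le (-p) q ht
  simp only [neg_dotProduct, dotProduct_neg, neg_neg] at h
  linarith

theorem dotProduct_self_nonneg_real {α : Type*} [Fintype α] (p : α → ℝ) : 0 ≤ p ⬝ᵥ p :=
  Finset.sum_nonneg fun i _ => mul_self_nonneg (p i)

theorem dotProduct_mulVec_self_le {α β : Type*} [Fintype α] [Fintype β] [DecidableEq β]
    {A : Matrix α β ℝ} {K : ℝ} (hA : specNorm A ≤ K) (x : β → ℝ) :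
    A.mulVec x ⬝ᵥ A.mulVec x ≤ K ^ 2 * (x ⬝ᵥ x) := by
  have h := (LinearMap.toContinuousLinearMap (Matrix.toEuclideanLin A)).le_of_opNorm_le hA
    (WithLp.toLp 2 x)
  have h2 := pow_le_pow_left₀ (norm_nonneg _) h 2
  rw [mul_pow, EuclideanSpace.real_norm_sq_eq, EuclideanSpace.real_norm_sq_eq] at h2
  simpa [dotProduct, sq, Matrix.toLpLin_apply] using h2

theorem dotProduct_mulVec_of_isSymm {α : Type*} [Fintype α] {A : Matrix α α ℝ} (hA : A.IsSymm)
    (x y : α → ℝ) : x ⬝ᵥ A.mulVec y = A.mulVec x ⬝ᵥ y := by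
  rw [dotProduct_mulVec, ← mulVec_transpose, hA.eq]

theorem dotProduct_transpose_mulVec_eq {α β : Type*} [Fintype α] [Fintype β] (A : Matrix α β ℝ)
    (x : β → ℝ) (y : α → ℝ) : x ⬝ᵥ Aᵀ.mulVec y = A.mulVec x ⬝ᵥ y := by
  rw [dotProduct_mulVec, vecMul_transpose]

/-- If `A * Aᵀ ⪰ γ I`, then every `x` splits into a kernel vector of `A` and an orthogonal
remainder controlled by `A x`. -/
theorem exists_ker_add_orthogonal {α β : Type*} [Fintype α] [Fintype β]
    {A : Matrix α β ℝ} {γ : ℝ} (hγ : 0 < γ)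
    (hA : ∀ y : α → ℝ, γ * (y ⬝ᵥ y) ≤ y ⬝ᵥ (A * Aᵀ).mulVec y) (x : β → ℝ) :
    ∃ u v : β → ℝ, x = u + v ∧ A.mulVec u = 0 ∧ u ⬝ᵥ v = 0 ∧
      γ * (v ⬝ᵥ v) ≤ A.mulVec x ⬝ᵥ A.mulVec x := by
  have hinj : Function.Injective (A * Aᵀ).mulVecLin := by
    rw [injective_iff_map_eq_zero]
    intro y hy
    rw [mulVecLin_apply] at hy
    have h := hA y
    rw [hy, dotProduct_zero] at h
    have h0 := dotProduct_self_nonneg_real y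
    exact dotProduct_self_eq_zero.mp (by nlinarith)
  obtain ⟨y, hy⟩ := LinearMap.injective_iff_surjective.mp hinj (A.mulVec x)
  rw [mulVecLin_apply] at hy
  have hv : A.mulVec (Aᵀ.mulVec y) = A.mulVec x := by rw [mulVec_mulVec, hy]
  have hu : A.mulVec (x - Aᵀ.mulVec y) = 0 := by rw [mulVec_sub, hv, sub_self]
  refine ⟨x - Aᵀ.mulVec y, Aᵀ.mulVec y, by simp, hu, ?_, ?_⟩
  · rw [dotProduct_transpose_mulVec_eq, hu, zero_dotProduct]
  · have h1 : Aᵀ.mulVec y ⬝ᵥ Aᵀ.mulVec y = y ⬝ᵥ A.mulVec x := by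
      rw [dotProduct_transpose_mulVec_eq, hv, dotProduct_comm]
    have h2 := hA y
    rw [hy] at h2
    have h3 := two_mul_dotProduct_le y (A.mulVec x) hγ
    have h4 : γ * (2 * (y ⬝ᵥ A.mulVec x)) ≤
        γ * (y ⬝ᵥ A.mulVec x + 1 / γ * (A.mulVec x ⬝ᵥ A.mulVec x)) :=
      mul_le_mul_of_nonneg_left (by linarith) hγ.le
    have h5 : γ * (1 / γ * (A.mulVec x ⬝ᵥ A.mulVec x)) = A.mulVec x ⬝ᵥ A.mulVec x := by
      field_simp
    rw [h1]
    linarith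

/-- Coercivity of a symmetric matrix on a subspace, perturbed off the subspace. -/
theorem le_dotProduct_mulVec_add {α : Type*} [Fintype α] [DecidableEq α] {A : Matrix α α ℝ}
    (hA : A.IsSymm) {γ K : ℝ} (hγ : 0 < γ) (hγ1 : γ ≤ 1) (hK : 1 ≤ K) (hAn : specNorm A ≤ K)
    (u v : α → ℝ) (hu : γ * (u ⬝ᵥ u) ≤ u ⬝ᵥ A.mulVec u) :
    γ / 2 * (u ⬝ᵥ u) - 3 * (K ^ 2 / γ * (v ⬝ᵥ v)) ≤ (u + v) ⬝ᵥ A.mulVec (u + v) := by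
  have hexp : (u + v) ⬝ᵥ A.mulVec (u + v)
      = u ⬝ᵥ A.mulVec u + 2 * (u ⬝ᵥ A.mulVec v) + v ⬝ᵥ A.mulVec v := by
    rw [mulVec_add, add_dotProduct, dotProduct_add, dotProduct_add,
      dotProduct_mulVec_of_isSymm hA v u, dotProduct_comm (A.mulVec v) u]
    ring
  have hn := dotProduct_mulVec_self_le hAn v
  have h1 := neg_two_mul_dotProduct_le u (A.mulVec v) (half_pos hγ)
  have h2 := neg_two_mul_dotProduct_le v (A.mulVec v) one_pos
  have hv := dotProduct_self_nonneg_real v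
  have h3 : 1 / (γ / 2) * (A.mulVec v ⬝ᵥ A.mulVec v) ≤ 2 * (K ^ 2 / γ * (v ⬝ᵥ v)) := by
    calc _ ≤ 1 / (γ / 2) * (K ^ 2 * (v ⬝ᵥ v)) := by gcongr
      _ = _ := by field_simp
  have hK2 : 1 ≤ K ^ 2 := one_le_pow₀ hK
  have h4 : v ⬝ᵥ v ≤ K ^ 2 * (v ⬝ᵥ v) := le_mul_of_one_le_left hv hK2
  have h5 : K ^ 2 * (v ⬝ᵥ v) ≤ K ^ 2 / γ * (v ⬝ᵥ v) :=
    mul_le_mul_of_nonneg_right (le_div_self (by positivity) hγ hγ1) hv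
  linarith

/-- The scalar estimate behind the descent property: `w, L, C, a, U, V` stand for the squared norms
of `Δx, Δl, c, g` and of the kernel and orthogonal components of `Δx`. -/
theorem newton_descent_scalar {γH γG Υ η₁ η₂ q cl s t w L C a U V : ℝ}
    (hγH : 0 < γH) (hγH1 : γH ≤ 1) (hγG : 0 < γG) (hγG1 : γG ≤ 1) (hΥ : 1 ≤ Υ)
    (hcc : 0 ≤ C) (huu : 0 ≤ U) (hvv : 0 ≤ V)
    (hcoer : γH / 2 * U - 3 * (Υ ^ 2 / γH * V) ≤ q) (hw : w = U + V) (hvc : γG * V ≤ C)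
    (hl : γG * L ≤ 2 * a + 2 * (Υ ^ 2 * w))
    (hcl : 2 * cl ≤ 8 / (η₂ * γG) * C + 1 / (8 / (η₂ * γG)) * L)
    (hr : s - t ≤ 3 / 8 * a + 8 / 3 * (Υ ^ 2 * w))
    (hη₂pos : 0 < η₂) (hη₂ : η₂ ≤ γH / (7 * Υ ^ 2)) (hη₁ : 9 / (η₂ * γG) ≤ η₁) :
    -q + 2 * cl - η₁ * C - η₂ * a + η₂ * s - η₂ * t ≤
      -(η₂ / 8) * (a + C) - (η₂ * γG / 8) * (w + L) := by
  have hΥ2 : 1 ≤ Υ ^ 2 := one_le_pow₀ hΥ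
  have hK : 7 * (η₂ * Υ ^ 2) ≤ γH := by
    rw [le_div_iff₀ (by positivity)] at hη₂
    linarith
  have hη₂1 : 7 * η₂ ≤ γH := by
    have := le_mul_of_one_le_right hη₂pos.le hΥ2
    linarith
  have hη₂G : η₂ * γG ≤ η₂ := mul_le_of_le_one_right hη₂pos.le hγG1
  have hw0 : 0 ≤ w := by linarith
  obtain ⟨P, hP⟩ : ∃ P, P = C / (η₂ * γG) := ⟨_, rfl⟩
  have hP0 : 0 ≤ P := by rw [hP]; positivity
  have hη₁P : 9 * P ≤ η₁ * C := by
    calc 9 * P = 9 / (η₂ * γG) * C := by rw [hP]; ring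
      _ ≤ _ := by gcongr
  have hVP : 7 * (Υ ^ 2 / γH * V) ≤ P := by
    have h1 : V ≤ η₂ * P := by
      rw [hP]
      calc V ≤ C / γG := by rw [le_div_iff₀ hγG]; linarith
        _ = _ := by field_simp
    calc 7 * (Υ ^ 2 / γH * V) ≤ 7 * (Υ ^ 2 / γH * (η₂ * P)) := by gcongr
      _ = 7 * (η₂ * Υ ^ 2) / γH * P := by ring
      _ ≤ 1 * P := by
        gcongr
        rwa [div_le_one hγH]
      _ = P := one_mul P
  have hγV : γH * V ≤ Υ ^ 2 / γH * V := by
    gcongr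
    rw [le_div_iff₀ hγH]
    exact (mul_le_one₀ hγH1 hγH.le hγH1).trans hΥ2
  have hCP : η₂ * C ≤ P := by
    rw [hP, le_div_iff₀ (by positivity)]
    have h1 : η₂ * (η₂ * γG) ≤ 1 :=
      mul_le_one₀ (by linarith) (by positivity) (by linarith)
    have h2 := mul_le_mul_of_nonneg_left h1 hcc
    linarith
  have hclP : 2 * cl ≤ 8 * P + η₂ * (γG * L) / 8 := by
    refine hcl.trans_eq ?_
    rw [hP]
    field_simp
  have hηw : 7 * (η₂ * (Υ ^ 2 * w)) ≤ γH * U + γH * V := by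
    have := mul_le_mul_of_nonneg_right hK hw0
    rw [hw] at this ⊢
    linarith
  have hηG : 7 * (η₂ * γG * w) ≤ γH * U + γH * V := by
    have h1 : 7 * (η₂ * γG) ≤ γH := by linarith
    have := mul_le_mul_of_nonneg_right h1 hw0
    rw [hw] at this ⊢
    linarith
  have hηl := mul_le_mul_of_nonneg_left hl hη₂pos.le
  have hcross := mul_le_mul_of_nonneg_left hr hη₂pos.le
  have hγU : 0 ≤ γH * U := by positivity
  linarith

/-- descent property of the exact Newton direction for the exact augmented
Lagrangian, in matrix form:
`⟨(Δx, Δl), M (g, c)⟩ ≤ −(η₂/8)(‖g‖² + ‖c‖²) − (η₂ γ_G/8)(‖Δx‖² + ‖Δl‖²)` with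
`M = [[I + η₂ H, η₁ Gᵀ], [η₂ G, I]]`. -/
theorem exact_newton_descent (n m : ℕ) (γH γG Υ η₁ η₂ : ℝ)
    (hγH : 0 < γH) (hγH1 : γH ≤ 1) (hγG : 0 < γG) (hγG1 : γG ≤ 1) (hΥ : 1 ≤ Υ)
    (Hh H : Matrix (Fin n) (Fin n) ℝ) (G : Matrix (Fin m) (Fin n) ℝ)
    (hHhsymm : Hh.IsSymm) (hHsymm : H.IsSymm)
    (hred : ∀ x : Fin n → ℝ, G.mulVec x = 0 → γH * (x ⬝ᵥ x) ≤ x ⬝ᵥ Hh.mulVec x)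
    (hGG : ∀ y : Fin m → ℝ, γG * (y ⬝ᵥ y) ≤ y ⬝ᵥ (G * Gᵀ).mulVec y)
    (hHhn : specNorm Hh ≤ Υ) (hHn : specNorm H ≤ Υ) (hGn : specNorm G ≤ Υ)
    (g Δx : Fin n → ℝ) (c Δl : Fin m → ℝ)
    (hN1 : Hh.mulVec Δx + Gᵀ.mulVec Δl = -g) (hN2 : G.mulVec Δx = -c)
    (hη₂pos : 0 < η₂) (hη₂ : η₂ ≤ γH / (7 * Υ ^ 2))
    (hη₁pos : 0 < η₁) (hη₁ : 9 / (η₂ * γG) ≤ η₁) :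
    Sum.elim Δx Δl ⬝ᵥ
        (Matrix.fromBlocks (1 + η₂ • H) (η₁ • Gᵀ) (η₂ • G) 1).mulVec (Sum.elim g c) ≤
      -(η₂ / 8) * (g ⬝ᵥ g + c ⬝ᵥ c) - (η₂ * γG / 8) * (Δx ⬝ᵥ Δx + Δl ⬝ᵥ Δl) := by
  obtain ⟨u, v, hx, hu, huv, hvc⟩ := exists_ker_add_orthogonal hγG hGG Δx
  have hcoer := le_dotProduct_mulVec_add hHhsymm hγH hγH1 hΥ hHhn u v (hred u hu)
  rw [← hx] at hcoer
  have hw : Δx ⬝ᵥ Δx = u ⬝ᵥ u + v ⬝ᵥ v := by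
    rw [hx, add_dotProduct, dotProduct_add, dotProduct_add, dotProduct_comm v u, huv]
    ring
  rw [hN2, neg_dotProduct, dotProduct_neg, neg_neg] at hvc
  have hGl : Gᵀ.mulVec Δl = -(g + Hh.mulVec Δx) := by
    rw [neg_add, ← hN1]
    abel
  have hHhx := dotProduct_mulVec_self_le hHhn Δx
  have hHx := dotProduct_mulVec_self_le hHn Δx
  have hxg : Δx ⬝ᵥ g = -(Δx ⬝ᵥ Hh.mulVec Δx) + c ⬝ᵥ Δl := by
    have h : g = -(Hh.mulVec Δx + Gᵀ.mulVec Δl) := by rw [hN1, neg_neg]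
    rw [h, dotProduct_neg, dotProduct_add, dotProduct_transpose_mulVec_eq, hN2, neg_dotProduct]
    ring
  have hlg : Δl ⬝ᵥ G.mulVec g = -(g ⬝ᵥ g) - Hh.mulVec Δx ⬝ᵥ g := by
    rw [dotProduct_comm, ← dotProduct_transpose_mulVec_eq, hGl, dotProduct_neg, dotProduct_add,
      dotProduct_comm g (Hh.mulVec Δx)]
    ring
  have hQ : Sum.elim Δx Δl ⬝ᵥ
        (Matrix.fromBlocks (1 + η₂ • H) (η₁ • Gᵀ) (η₂ • G) 1).mulVec (Sum.elim g c) =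
      -(Δx ⬝ᵥ Hh.mulVec Δx) + 2 * (c ⬝ᵥ Δl) - η₁ * (c ⬝ᵥ c) - η₂ * (g ⬝ᵥ g)
        + η₂ * (H.mulVec Δx ⬝ᵥ g) - η₂ * (Hh.mulVec Δx ⬝ᵥ g) := by
    rw [fromBlocks_mulVec, sumElim_dotProduct_sumElim]
    simp only [Sum.elim_comp_inl, Sum.elim_comp_inr, add_mulVec, one_mulVec, smul_mulVec,
      dotProduct_add, dotProduct_smul, smul_eq_mul]
    rw [hxg, hlg, dotProduct_transpose_mulVec_eq, hN2, neg_dotProduct,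
      dotProduct_mulVec_of_isSymm hHsymm, dotProduct_comm Δl c]
    ring
  have hl : γG * (Δl ⬝ᵥ Δl) ≤ 2 * (g ⬝ᵥ g) + 2 * (Υ ^ 2 * (Δx ⬝ᵥ Δx)) := by
    have h1 := hGG Δl
    rw [← mulVec_mulVec, dotProduct_comm Δl (G.mulVec _), ← dotProduct_transpose_mulVec_eq, hGl, neg_dotProduct,
      dotProduct_neg, neg_neg, add_dotProduct, dotProduct_add, dotProduct_add,
      dotProduct_comm (Hh.mulVec Δx) g] at h1
    have h2 := two_mul_dotProduct_le g (Hh.mulVec Δx) one_pos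
    linarith
  have hc1 := two_mul_dotProduct_le g (H.mulVec Δx) (t := 3 / 8) (by norm_num)
  have hc2 := neg_two_mul_dotProduct_le g (Hh.mulVec Δx) (t := 3 / 8) (by norm_num)
  rw [dotProduct_comm g] at hc1 hc2
  have hcl := two_mul_dotProduct_le c Δl (t := 8 / (η₂ * γG)) (by positivity)
  rw [hQ]
  exact newton_descent_scalar hγH hγH1 hγG hγG1 hΥ (dotProduct_self_nonneg_real c)
    (dotProduct_self_nonneg_real u) (dotProduct_self_nonneg_real v) hcoer hw hvc hl hcl
    (by linarith) hη₂pos hη₂ hη₁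
end

section
/- Let Ĥ be an n×n real matrix and G an m×n real matrix, let g ∈ ℝⁿ, c ∈ ℝᵐ, and suppose (ω, ζ) ∈ ℝⁿ × ℝᵐ satisfies the full KKT system Ĥω + Gᵀζ = −g and c + Gω = 0. Let W and B̄ be disjoint subsets of the column indices {1,…,n}, let S and Ŝ be disjoint subsets of the row indices {1,…,m}, and let T denote the remaining row indices. Assume the zero patterns: G[S][Wᶜ] = 0 (where Wᶜ is the complement of W in the column indices), G[Ŝ][(W ∪ B̄)ᶜ] = 0, Ĥ[W][(W ∪ B̄)ᶜ] = 0, and G[T][W] = 0. Then for every real μ, the truncated pair (ω[W], ζ[S]) together with the boundary values (ω[B̄], ζ[Ŝ]) satisfies the subproblem KKT conditions: (i) G[S][W]·ω[W] = −c[S]; and (ii) Ĥ[W][W]·ω[W] + Ĥ[W][B̄]·ω[B̄] + (G[Ŝ][W])ᵀ·ζ[Ŝ] + (G[S][W])ᵀ·ζ[S] + μ·(G[Ŝ][W])ᵀ·( c[Ŝ] + G[Ŝ][W]·ω[W] + G[Ŝ][B̄]·ω[B̄] ) = −g[W]. -/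
open Matrix

/-- The submatrix `A[S][W]` of `A` with rows in `S` and columns in `W`. -/
def subMat {α β : Type*} (A : Matrix α β ℝ) (S : Finset α) (W : Finset β) :
    Matrix {i // i ∈ S} {j // j ∈ W} ℝ :=
  A.submatrix (fun i : {i // i ∈ S} => (i : α)) (fun j : {j // j ∈ W} => (j : β))

/-- The subvector `v[S]` of `v` with entries in `S`. -/
def subVec {α : Type*} (v : α → ℝ) (S : Finset α) : {i // i ∈ S} → ℝ :=
  fun i => v i

theorem subMat_mulVec_apply {α β : Type*} (A : Matrix α β ℝ) (v : β → ℝ)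
    (S : Finset α) (U : Finset β) (i : {i // i ∈ S}) :
    (subMat A S U).mulVec (subVec v U) i = ∑ j ∈ U, A i j * v j :=
  Finset.sum_coe_sort U fun j => A i j * v j

theorem subMat_mulVec_of_compl_eq_zero {α β : Type*} [Fintype β] [DecidableEq β]
    (A : Matrix α β ℝ) (v : β → ℝ) (S : Finset α) (U : Finset β) (h : subMat A S Uᶜ = 0) :
    (subMat A S U).mulVec (subVec v U) = subVec (A.mulVec v) S := by
  ext i
  rw [subMat_mulVec_apply]
  refine Finset.sum_subset (Finset.subset_univ U) fun j _ hj => ?_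
  have hij : A i j = 0 := congrFun (congrFun h i) ⟨j, Finset.mem_compl.mpr hj⟩
  rw [hij, zero_mul]

theorem subMat_mulVec_add_of_compl_union_eq_zero {α β : Type*} [Fintype β] [DecidableEq β]
    (A : Matrix α β ℝ) (v : β → ℝ) (S : Finset α) {U V : Finset β} (hUV : Disjoint U V)
    (h : subMat A S (U ∪ V)ᶜ = 0) :
    (subMat A S U).mulVec (subVec v U) + (subMat A S V).mulVec (subVec v V) =
      subVec (A.mulVec v) S := by
  rw [← subMat_mulVec_of_compl_eq_zero A v S (U ∪ V) h]
  ext i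
  simp only [Pi.add_apply, subMat_mulVec_apply, Finset.sum_union hUV]

/-- the truncation of a full KKT solution satisfies the overlapping-subproblem
KKT conditions with exact boundary data.  Here `W` and `Bb` (= `B̄`) are disjoint column index
sets, `S` and `Sh` (= `Ŝ`) are disjoint row index sets, and `T = (S ∪ Ŝ)ᶜ` the remaining rows. -/
theorem truncation_solves_subproblem (n m : ℕ)
    (Hh : Matrix (Fin n) (Fin n) ℝ) (G : Matrix (Fin m) (Fin n) ℝ)
    (g ω : Fin n → ℝ) (c ζ : Fin m → ℝ)
    (hKKT1 : Hh.mulVec ω + Gᵀ.mulVec ζ = -g) (hKKT2 : c + G.mulVec ω = 0)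
    (W Bb : Finset (Fin n)) (hWB : Disjoint W Bb)
    (S Sh : Finset (Fin m)) (hSS : Disjoint S Sh)
    (hGS : subMat G S Wᶜ = 0)
    (hGSh : subMat G Sh (W ∪ Bb)ᶜ = 0)
    (hHW : subMat Hh W (W ∪ Bb)ᶜ = 0)
    (hGT : subMat G (S ∪ Sh)ᶜ W = 0) :
    ∀ μ : ℝ,
      (subMat G S W).mulVec (subVec ω W) = -subVec c S ∧
      (subMat Hh W W).mulVec (subVec ω W) + (subMat Hh W Bb).mulVec (subVec ω Bb)
          + (subMat G Sh W)ᵀ.mulVec (subVec ζ Sh) + (subMat G S W)ᵀ.mulVec (subVec ζ S)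
          + μ • (subMat G Sh W)ᵀ.mulVec
              (subVec c Sh + (subMat G Sh W).mulVec (subVec ω W)
                + (subMat G Sh Bb).mulVec (subVec ω Bb))
        = -subVec g W := by
  intro μ
  have hres (R : Finset (Fin m)) : subVec c R + subVec (G.mulVec ω) R = 0 :=
    funext fun i => congrFun hKKT2 i
  have hstat : subVec (Hh.mulVec ω) W + subVec (Gᵀ.mulVec ζ) W = -subVec g W :=
    funext fun i => congrFun hKKT1 i
  have hGT' : subMat Gᵀ W (S ∪ Sh)ᶜ = 0 := congrArg transpose hGT
  have hH := subMat_mulVec_add_of_compl_union_eq_zero Hh ω W hWB hHW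
  have hG := subMat_mulVec_add_of_compl_union_eq_zero Gᵀ ζ W hSS hGT'
  have hGS' := subMat_mulVec_of_compl_eq_zero G ω S W hGS
  have hSh := subMat_mulVec_add_of_compl_union_eq_zero G ω Sh hWB hGSh
  have htr (R : Finset (Fin m)) : (subMat G R W)ᵀ = subMat Gᵀ W R := rfl
  constructor
  · rw [hGS']
    exact eq_neg_of_add_eq_zero_right (hres S)
  · rw [add_assoc (subVec c Sh), hSh, hres Sh, mulVec_zero, smul_zero, add_zero, hH, htr, htr,
      add_assoc, add_comm (mulVec _ (subVec ζ Sh)), hG, hstat]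
end
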